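/- There exists a finite directed graph G that is not irreducible and a graph-directed Bedford–McMullen carpet X generated over G such that dim_H X = dim_B X < dim_A X. Concretely, the two-vertex (×3,×4)-carpet family {X_a, X_b} in which vertex a carries the seven maps with digit pairs (0,1),(2,0),(2,1),(2,2),(3,0),(3,1),(3,2) all directed to a except the map with digit pair (1,1) directed to b, and vertex b carries the seven maps with digit pairs (0,1),(2,0),(2,1),(2,2) directed to b and (1,2),(2,2),(3,2)-type top-row maps directed to b (as in Figure 5 of the paper), satisfies dim_H X = dim_B X = 3/2, dim_A X = 2, and dim_L X = 1 for X = X_a ∪ X_b. -/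

import Mathlib

open Set Filter Topology Metric
open scoped Classical

noncomputable section

/-- Least cardinality of a finite set of centers of closed balls of radius `r` covering `E`. -/
def coverNum {X : Type*} [PseudoMetricSpace X] (r : ℝ) (E : Set X) : ℕ :=
  sInf {k : ℕ | ∃ S : Finset X, S.card = k ∧ E ⊆ ⋃ x ∈ S, Metric.closedBall x r}

/-- Upper box (Minkowski) dimension. -/
def upperBoxDim {X : Type*} [PseudoMetricSpace X] (E : Set X) : ℝ :=
  limsup (fun r : ℝ => Real.log (coverNum r E) / Real.log (1 / r)) (𝓝[>] (0 : ℝ))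

/-- Lower box (Minkowski) dimension. -/
def lowerBoxDim {X : Type*} [PseudoMetricSpace X] (E : Set X) : ℝ :=
  liminf (fun r : ℝ => Real.log (coverNum r E) / Real.log (1 / r)) (𝓝[>] (0 : ℝ))

/-- The box dimension (well-defined when `lowerBoxDim E = upperBoxDim E`). -/
def boxDim {X : Type*} [PseudoMetricSpace X] (E : Set X) : ℝ := upperBoxDim E

/-- Assouad dimension. -/
def assouadDim {X : Type*} [PseudoMetricSpace X] (E : Set X) : ℝ :=
  sInf {s : ℝ | 0 ≤ s ∧ ∃ C : ℝ, 0 < C ∧ ∀ x ∈ E, ∀ r R : ℝ,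
    0 < r → r < R → R ≤ 1 →
    (coverNum r (E ∩ Metric.ball x R) : ℝ) ≤ C * (R / r) ^ s}

/-- Lower dimension. -/
def lowerDim {X : Type*} [PseudoMetricSpace X] (E : Set X) : ℝ :=
  sSup {s : ℝ | 0 ≤ s ∧ ∃ C : ℝ, 0 < C ∧ ∀ x ∈ E, ∀ r R : ℝ,
    0 < r → r < R → R ≤ 1 →
    C * (R / r) ^ s ≤ (coverNum r (E ∩ Metric.ball x R) : ℝ)}

/-- A graph-directed Bedford–McMullen `(×m,×n)`-carpet family: a finite directed graph
`(V, E)` (loops and multiple edges allowed) in which every vertex emits an edge, each edge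
carrying a digit pair `(x_e, y_e) ∈ {0,…,n−1} × {0,…,m−1}`, together with the unique family
of nonempty compact attractors `X v ⊆ [0,1]²` satisfying
`X v = ⋃_{e : src e = v} ψ_e (X (tgt e))` where `ψ_e (ξ₁, ξ₂) = ((ξ₁+x_e)/n, (ξ₂+y_e)/m)`. -/
structure GDBMCarpet where
  m : ℕ
  n : ℕ
  hm : 2 ≤ m
  hmn : m < n
  V : Type
  E : Type
  fintypeV : Fintype V
  fintypeE : Fintype E
  decV : DecidableEq V
  decE : DecidableEq E
  src : E → V
  tgt : E → V
  xd : E → Fin n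
  yd : E → Fin m
  src_surj : ∀ v : V, ∃ e : E, src e = v
  X : V → Set (ℝ × ℝ)
  X_nonempty : ∀ v, (X v).Nonempty
  X_compact : ∀ v, IsCompact (X v)
  X_subset : ∀ v, X v ⊆ Set.Icc (0 : ℝ) 1 ×ˢ Set.Icc (0 : ℝ) 1
  X_invariant : ∀ v, X v =
    ⋃ e ∈ {e : E | src e = v},
      (fun p : ℝ × ℝ => ((p.1 + (xd e : ℝ)) / n, (p.2 + (yd e : ℝ)) / m)) '' X (tgt e)

attribute [instance] GDBMCarpet.fintypeV GDBMCarpet.fintypeE GDBMCarpet.decV GDBMCarpet.decE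

namespace GDBMCarpet

variable (S : GDBMCarpet)

/-- The contraction `ψ_e`. -/
def psi (e : S.E) : ℝ × ℝ → ℝ × ℝ :=
  fun p => ((p.1 + (S.xd e : ℝ)) / S.n, (p.2 + (S.yd e : ℝ)) / S.m)

/-- The projected contraction `φ_e` on the second coordinate axis. -/
def phi (e : S.E) : ℝ → ℝ := fun t => (t + (S.yd e : ℝ)) / S.m

/-- The carpet `X = ⋃_{v ∈ V} X_v`. -/
def Xunion : Set (ℝ × ℝ) := ⋃ v : S.V, S.X v

/-- The projection `π(ξ₁,ξ₂) = ξ₂` onto the second coordinate axis. -/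
def proj : ℝ × ℝ → ℝ := Prod.snd

/-- The open unit square `(0,1)²`. -/
def openSquare : Set (ℝ × ℝ) := Set.Ioo (0 : ℝ) 1 ×ˢ Set.Ioo (0 : ℝ) 1

/-- `w : Fin k → E` is an admissible word along the graph. -/
def IsWord (k : ℕ) (w : Fin k → S.E) : Prop :=
  ∀ (i : ℕ) (h : i + 1 < k), S.tgt (w ⟨i, Nat.lt_of_succ_lt h⟩) = S.src (w ⟨i + 1, h⟩)

/-- The word `w` has initial vertex `v` (vacuous for the empty word). -/
def wordStart (k : ℕ) (w : Fin k → S.E) (v : S.V) : Prop :=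
  ∀ h : 0 < k, S.src (w ⟨0, h⟩) = v

/-- The terminal vertex `t(w)` of a nonempty word. -/
def wordEnd {k : ℕ} (hk : 0 < k) (w : Fin k → S.E) : S.V :=
  S.tgt (w ⟨k - 1, Nat.sub_lt hk one_pos⟩)

/-- `ψ_w = ψ_{w₁} ∘ ⋯ ∘ ψ_{w_k}`. -/
def psiWord (k : ℕ) (w : Fin k → S.E) : ℝ × ℝ → ℝ × ℝ :=
  (List.ofFn (fun i => S.psi (w i))).foldr (· ∘ ·) id

/-- `φ_w = φ_{w₁} ∘ ⋯ ∘ φ_{w_k}`. -/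
def phiWord (k : ℕ) (w : Fin k → S.E) : ℝ → ℝ :=
  (List.ofFn (fun i => S.phi (w i))).foldr (· ∘ ·) id

/-- `η(v,x,y) = dim_B π(X_v ∩ ψ_w((0,1)²))` if some admissible word `w` with `i(w) = v`
has digit strings `(x, y)`, and `0` otherwise.  (The set `ψ_w((0,1)²)` depends only on the
digit strings, so the choice of witness is immaterial.) -/
def eta (v : S.V) (k : ℕ) (x : Fin k → Fin S.n) (y : Fin k → Fin S.m) : ℝ :=
  if h : ∃ w : Fin k → S.E, S.IsWord k w ∧ S.wordStart k w v ∧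
      (∀ i, S.xd (w i) = x i) ∧ (∀ i, S.yd (w i) = y i) then
    boxDim (GDBMCarpet.proj '' (S.X v ∩ S.psiWord k h.choose '' GDBMCarpet.openSquare))
  else 0

/-- The open interval `I_{y'}` associated with a finite word `y'` over `Σ_Y`. -/
def Iy (l : ℕ) (y : Fin l → Fin S.m) : Set ℝ :=
  Set.Ioo (∑ i : Fin l, (y i : ℝ) / (S.m : ℝ) ^ ((i : ℕ) + 1))
    ((∑ i : Fin l, (y i : ℝ) / (S.m : ℝ) ^ ((i : ℕ) + 1)) + 1 / (S.m : ℝ) ^ l)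

/-- `θ(v, x, y, y')`:  equals `η(v,x,y)` when `y' = ∅`, and equals
`dim_B (π(X_v ∩ ψ_w((0,1)²)) ∩ φ_w(I_{y'}))` when `y' ≠ ∅` (with `0` when no witness
word exists). -/
def theta (v : S.V) (k : ℕ) (x : Fin k → Fin S.n) (y : Fin k → Fin S.m)
    (l : ℕ) (y' : Fin l → Fin S.m) : ℝ :=
  if l = 0 then S.eta v k x y
  else if h : ∃ w : Fin k → S.E, S.IsWord k w ∧ S.wordStart k w v ∧
      (∀ i, S.xd (w i) = x i) ∧ (∀ i, S.yd (w i) = y i) then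
    boxDim ((GDBMCarpet.proj '' (S.X v ∩ S.psiWord k h.choose '' GDBMCarpet.openSquare)) ∩
      S.phiWord k h.choose '' S.Iy l y')
  else 0

/-- `Ṽ`: vertices that are terminal vertices of admissible words of length at least `#V`. -/
def Vtilde : Set S.V :=
  {v | ∃ (k : ℕ) (hk : 0 < k), Fintype.card S.V ≤ k ∧
    ∃ w : Fin k → S.E, S.IsWord k w ∧ S.wordEnd hk w = v}

/-- The `x`-digit strings realized by admissible words of length `k` starting from `v`
with `y`-digit string `y`; these index the equivalence classes `[w] ∈ [E^k]` with
`i(w) = v` and `y_w = y` (a class is determined by its digit strings). -/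
def realizedX (v : S.V) (k : ℕ) (y : Fin k → Fin S.m) : Finset (Fin k → Fin S.n) :=
  Finset.univ.filter (fun x => ∃ w : Fin k → S.E, S.IsWord k w ∧ S.wordStart k w v ∧
    (∀ i, S.xd (w i) = x i) ∧ (∀ i, S.yd (w i) = y i))

/-- The digit-string pairs realized by admissible words of length `k` from `v`; these
index the classes `[w]` with `w ∈ E^k`, `i(w) = v`. -/
def realizedXY (v : S.V) (k : ℕ) : Finset ((Fin k → Fin S.n) × (Fin k → Fin S.m)) :=
  Finset.univ.filter (fun xy => ∃ w : Fin k → S.E, S.IsWord k w ∧ S.wordStart k w v ∧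
    (∀ i, S.xd (w i) = xy.1 i) ∧ (∀ i, S.yd (w i) = xy.2 i))

/-- `α_k = max_{v∈Ṽ} max_{y∈Σ_Y^k} Σ_{[w]∈[E^k] : i(w)=v, y_w=y} n^{k·η(v,x_w,y_w)}`. -/
def alphaSeq (k : ℕ) : ℝ :=
  ⨆ v ∈ S.Vtilde, ⨆ y : Fin k → Fin S.m,
    ∑ x ∈ S.realizedX v k y, (S.n : ℝ) ^ ((k : ℝ) * S.eta v k x y)

/-- `τ_k = max_{v ∈ V} #{[w] : w ∈ E^k, i(w) = v}`. -/
def tauSeq (k : ℕ) : ℕ :=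
  Finset.univ.sup (fun v : S.V => (S.realizedXY v k).card)

/-- `t([w])`: the set of terminal vertices of words equivalent to `w` (words with the
same digit strings). -/
def termSet (k : ℕ) (hk : 0 < k) (w : Fin k → S.E) : Set S.V :=
  {v | ∃ w' : Fin k → S.E, S.IsWord k w' ∧ (∀ i, S.xd (w' i) = S.xd (w i)) ∧
    (∀ i, S.yd (w' i) = S.yd (w i)) ∧ S.wordEnd hk w' = v}

/-- The inner collection in the definition of `β_k`. -/
def betaInner (v : S.V) (k : ℕ) : Set ℝ :=
  {c | ∃ (y : Fin k → Fin S.m) (l : ℕ) (y' : Fin l → Fin S.m),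
    (0 < ∑ x ∈ S.realizedX v k y, S.theta v k x y l y') ∧
    c = ∑ x ∈ S.realizedX v k y,
      (if 0 < S.theta v k x y l y' then (S.n : ℝ) ^ ((k : ℝ) * S.theta v k x y l y') else 0)}

/-- `β_k`. -/
def betaSeq (k : ℕ) : ℝ :=
  sInf {b | ∃ (l : ℕ) (hl : 0 < l) (w : Fin l → S.E),
    Fintype.card S.V ≤ l ∧ S.IsWord l w ∧
    b = ⨆ v ∈ S.termSet l hl w, sInf (S.betaInner v k)}

/-- `β = liminf_{k→∞} (β_k)^{1/k}`. -/
def betaVal : ℝ := liminf (fun k : ℕ => (S.betaSeq k) ^ ((k : ℝ)⁻¹)) atTop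

/-- `l = ⌊k·log_n m⌋`, so that `n^l ≤ m^k < n^{l+1}`. -/
def lvl (k : ℕ) : ℕ := Nat.floor ((k : ℝ) * Real.logb S.n S.m)

/-- The approximate square `Q_k(p,q) = [p/n^l, (p+1)/n^l] × [q/m^k, (q+1)/m^k]`. -/
def approxSq (k : ℕ) (p q : ℤ) : Set (ℝ × ℝ) :=
  Set.Icc ((p : ℝ) / (S.n : ℝ) ^ S.lvl k) (((p : ℝ) + 1) / (S.n : ℝ) ^ S.lvl k) ×ˢ
  Set.Icc ((q : ℝ) / (S.m : ℝ) ^ k) (((q : ℝ) + 1) / (S.m : ℝ) ^ k)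

/-- `N_k(F)` for `F ⊆ ℝ²`: least number of level-`k` approximate squares covering `F`. -/
def NkSq (k : ℕ) (F : Set (ℝ × ℝ)) : ℕ :=
  sInf {c : ℕ | ∃ T : Finset (ℤ × ℤ), T.card = c ∧ F ⊆ ⋃ pq ∈ T, S.approxSq k pq.1 pq.2}

/-- `N_k(F)` for `F ⊆ ℝ`: least number of intervals `[i/m^k, (i+1)/m^k]` covering `F`. -/
def NkInt (k : ℕ) (F : Set ℝ) : ℕ :=
  sInf {c : ℕ | ∃ T : Finset ℤ, T.card = c ∧
    F ⊆ ⋃ i ∈ T, Set.Icc ((i : ℝ) / (S.m : ℝ) ^ k) (((i : ℝ) + 1) / (S.m : ℝ) ^ k)}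

/-- The adjacency matrix `A` of `G`. -/
def adjMat : Matrix S.V S.V ℕ :=
  fun v v' => (Finset.univ.filter (fun e : S.E => S.src e = v ∧ S.tgt e = v')).card

/-- The matrices `A_j`, `0 ≤ j < m`, with `A_j(v,v') = #{e : v →e v', y_e = j}` (real
entries). -/
def Amat (j : Fin S.m) : Matrix S.V S.V ℝ :=
  fun v v' =>
    ((Finset.univ.filter (fun e : S.E => S.src e = v ∧ S.tgt e = v' ∧ S.yd e = j)).card : ℝ)

/-- `G` is irreducible: `Σ_{j ≥ 1} A^j` is positive. -/
def GraphIrreducible : Prop :=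
  ∀ v v' : S.V, ∃ k : ℕ, 0 < k ∧ 0 < (S.adjMat ^ k) v v'

/-- The rectangular open set condition. -/
def ROSC : Prop :=
  ∀ v : S.V, (∀ e : S.E, S.src e = v → S.psi e '' GDBMCarpet.openSquare ⊆ GDBMCarpet.openSquare) ∧
    ∀ e e' : S.E, S.src e = v → S.src e' = v → e ≠ e' →
      Disjoint (S.psi e '' GDBMCarpet.openSquare) (S.psi e' '' GDBMCarpet.openSquare)

/-- The words `I^k` of length `k` appearing in the symbolic space `I ⊆ (Σ_X × Σ_Y)^ℕ`. -/
def Ik (k : ℕ) : Finset (Fin k → Fin S.n × Fin S.m) :=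
  Finset.univ.filter (fun f => ∃ w : Fin k → S.E, S.IsWord k w ∧
    ∀ i, (S.xd (w i), S.yd (w i)) = f i)

/-- The words `(πI)^k` of length `k` appearing in `πI ⊆ Σ_Y^ℕ`. -/
def piIk (k : ℕ) : Finset (Fin k → Fin S.m) :=
  Finset.univ.filter (fun y => ∃ w : Fin k → S.E, S.IsWord k w ∧ ∀ i, S.yd (w i) = y i)

/-- `h_top(I) = lim_k (1/k) log #I^k`. -/
def hTopI : ℝ := limsup (fun k : ℕ => Real.log (S.Ik k).card / (k : ℝ)) atTop

/-- `h_top(πI) = lim_k (1/k) log #(πI)^k`. -/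
def hTopPiI : ℝ := limsup (fun k : ℕ => Real.log (S.piIk k).card / (k : ℝ)) atTop

/-- The symbolic projection space `πI ⊆ Σ_Y^ℕ`. -/
def piI : Set (ℕ → Fin S.m) :=
  {y | ∃ ω : ℕ → S.E, (∀ i, S.tgt (ω i) = S.src (ω (i + 1))) ∧ ∀ i, S.yd (ω i) = y i}

/-- The `x`-strings of length-`k` words lying over `y|_k`. -/
def fiberXk (y : ℕ → Fin S.m) (k : ℕ) : Finset (Fin k → Fin S.n) :=
  Finset.univ.filter (fun x => ∃ w : Fin k → S.E, S.IsWord k w ∧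
    (∀ i : Fin k, S.yd (w i) = y (i : ℕ)) ∧ ∀ i, S.xd (w i) = x i)

/-- `h_top(π⁻¹(y)) = limsup_k (1/k) log #{x_w : w ∈ E^k, y_w = y|_k}`. -/
def hTopFiber (y : ℕ → Fin S.m) : ℝ :=
  limsup (fun k : ℕ => Real.log (S.fiberXk y k).card / (k : ℝ)) atTop

/-- Words staying within the subgraph spanned by the vertex set `W`. -/
def InWord (W : Set S.V) (k : ℕ) (w : Fin k → S.E) : Prop :=
  S.IsWord k w ∧ ∀ i, S.src (w i) ∈ W ∧ S.tgt (w i) ∈ W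

/-- There is a directed path inside `W` from `v` to `v'`. -/
def PathIn (W : Set S.V) (v v' : S.V) : Prop :=
  ∃ (k : ℕ) (hk : 0 < k) (w : Fin k → S.E), S.InWord W k w ∧
    S.src (w ⟨0, hk⟩) = v ∧ S.wordEnd hk w = v'

/-- The subgraph spanned by `W` is irreducible. -/
def IsIrred (W : Set S.V) : Prop :=
  W.Nonempty ∧ ∀ v ∈ W, ∀ v' ∈ W, S.PathIn W v v'

/-- `W` spans an irreducible component of `G` (a maximal irreducible subgraph). -/
def IsIrredComponent (W : Set S.V) : Prop :=
  S.IsIrred W ∧ ∀ W' : Set S.V, W ⊆ W' → S.IsIrred W' → W' = W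

/-- There is a directed path in `G` from a vertex of `W` to a vertex of `W'`
(defining `{i}⁺`). -/
def Reaches (W W' : Set S.V) : Prop :=
  ∃ v ∈ W, ∃ v' ∈ W', S.PathIn Set.univ v v'

/-- `(I_H)^k` for the subgraph spanned by `W`. -/
def IkIn (W : Set S.V) (k : ℕ) : Finset (Fin k → Fin S.n × Fin S.m) :=
  Finset.univ.filter (fun f => ∃ w : Fin k → S.E, S.InWord W k w ∧
    ∀ i, (S.xd (w i), S.yd (w i)) = f i)

/-- `(πI_H)^k` for the subgraph spanned by `W`. -/
def piIkIn (W : Set S.V) (k : ℕ) : Finset (Fin k → Fin S.m) :=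
  Finset.univ.filter (fun y => ∃ w : Fin k → S.E, S.InWord W k w ∧ ∀ i, S.yd (w i) = y i)

/-- `h_top(I_H)`. -/
def hTopIIn (W : Set S.V) : ℝ :=
  limsup (fun k : ℕ => Real.log (S.IkIn W k).card / (k : ℝ)) atTop

/-- `h_top(πI_H)`. -/
def hTopPiIIn (W : Set S.V) : ℝ :=
  limsup (fun k : ℕ => Real.log (S.piIkIn W k).card / (k : ℝ)) atTop

/-- `πI_H` for the subgraph spanned by `W`. -/
def piIIn (W : Set S.V) : Set (ℕ → Fin S.m) :=
  {y | ∃ ω : ℕ → S.E, (∀ i, S.tgt (ω i) = S.src (ω (i + 1))) ∧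
    (∀ i, S.src (ω i) ∈ W ∧ S.tgt (ω i) ∈ W) ∧ ∀ i, S.yd (ω i) = y i}

/-- The `x`-strings of length-`k` words of the subgraph spanned by `W` lying over `y|_k`. -/
def fiberXkIn (W : Set S.V) (y : ℕ → Fin S.m) (k : ℕ) : Finset (Fin k → Fin S.n) :=
  Finset.univ.filter (fun x => ∃ w : Fin k → S.E, S.InWord W k w ∧
    (∀ i : Fin k, S.yd (w i) = y (i : ℕ)) ∧ ∀ i, S.xd (w i) = x i)

/-- `h_top(π⁻¹(y) ∩ I_H)`. -/
def hTopFiberIn (W : Set S.V) (y : ℕ → Fin S.m) : ℝ :=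
  limsup (fun k : ℕ => Real.log (S.fiberXkIn W y k).card / (k : ℝ)) atTop

end GDBMCarpet

section Covers

/-- A cover witnessing an upper bound for `coverNum`. -/
lemma coverNum_le_card {X : Type*} [PseudoMetricSpace X] {r : ℝ} {E : Set X} (S : Finset X)
    (h : E ⊆ ⋃ x ∈ S, closedBall x r) : coverNum r E ≤ S.card :=
  Nat.sInf_le ⟨S, rfl, h⟩

lemma exists_natFloor_near {a w r t : ℝ} (hr : 0 < r) (ht : t ∈ Icc a (a + w)) :
    ∃ i ∈ Finset.range (⌊w / r⌋₊ + 1), |t - (a + i * r)| ≤ r := by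
  have h0 : 0 ≤ (t - a) / r := div_nonneg (by linarith [ht.1]) hr.le
  refine ⟨⌊(t - a) / r⌋₊, ?_, ?_⟩
  · rw [Finset.mem_range, Nat.lt_succ_iff]
    exact Nat.floor_le_floor (by gcongr; linarith [ht.2])
  · have h1 := Nat.floor_le h0
    have h2 := (Nat.lt_floor_add_one ((t - a) / r)).le
    rw [le_div_iff₀ hr] at h1
    rw [div_le_iff₀ hr] at h2
    rw [abs_le]
    constructor <;> linarith

/-- A `w × h` rectangle is covered by `(w/r + 1)(h/r + 1)` balls of radius `r`. -/
lemma exists_cover_rectangle {a b w h r : ℝ} (hr : 0 < r) (hw : 0 ≤ w) (hh : 0 ≤ h) :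
    ∃ S : Finset (ℝ × ℝ), (S.card : ℝ) ≤ (w / r + 1) * (h / r + 1) ∧
      Icc a (a + w) ×ˢ Icc b (b + h) ⊆ ⋃ x ∈ S, closedBall x r := by
  refine ⟨(Finset.range (⌊w / r⌋₊ + 1) ×ˢ Finset.range (⌊h / r⌋₊ + 1)).image
    fun ij => (a + ij.1 * r, b + ij.2 * r), ?_, ?_⟩
  · refine (Nat.cast_le.2 Finset.card_image_le).trans ?_
    rw [Finset.card_product, Finset.card_range, Finset.card_range]
    push_cast
    gcongr
    · exact Nat.floor_le (by positivity)
    · exact Nat.floor_le (by positivity)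
  · rintro ⟨x, y⟩ ⟨hx, hy⟩
    obtain ⟨i, hi, hxi⟩ := exists_natFloor_near hr hx
    obtain ⟨j, hj, hyj⟩ := exists_natFloor_near hr hy
    refine mem_biUnion (x := (a + i * r, b + j * r)) ?_ ?_
    · exact Finset.mem_coe.2 (Finset.mem_image.2 ⟨(i, j), Finset.mk_mem_product hi hj, rfl⟩)
    · rw [mem_closedBall, Prod.dist_eq]
      exact max_le (by simpa [Real.dist_eq] using hxi) (by simpa [Real.dist_eq] using hyj)

lemma coverNum_rectangle_le {a b w h r : ℝ} {E : Set (ℝ × ℝ)} (hr : 0 < r) (hw : 0 ≤ w)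
    (hh : 0 ≤ h) (hE : E ⊆ Icc a (a + w) ×ˢ Icc b (b + h)) :
    (coverNum r E : ℝ) ≤ (w / r + 1) * (h / r + 1) := by
  obtain ⟨S, hS, hc⟩ := exists_cover_rectangle (a := a) (b := b) hr hw hh
  exact (Nat.cast_le.2 (coverNum_le_card S (hE.trans hc))).trans hS

/-- A subset of the unit square attains its covering number. -/
lemma exists_card_eq_coverNum {r : ℝ} {E : Set (ℝ × ℝ)} (hr : 0 < r)
    (hE : E ⊆ Icc (0 : ℝ) 1 ×ˢ Icc (0 : ℝ) 1) :
    ∃ S : Finset (ℝ × ℝ), S.card = coverNum r E ∧ E ⊆ ⋃ x ∈ S, closedBall x r := by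
  obtain ⟨S, -, hS⟩ := exists_cover_rectangle (a := 0) (b := 0) hr zero_le_one zero_le_one
  rw [zero_add] at hS
  exact Nat.sInf_mem (s := {k | ∃ S : Finset (ℝ × ℝ), S.card = k ∧
    E ⊆ ⋃ x ∈ S, closedBall x r}) ⟨S.card, S, rfl, hE.trans hS⟩

/-- If the second projection of `E` contains an interval of length `h`, then covering `E` takes
at least `h / (2r)` balls. -/
lemma le_card_mul_of_Icc_subset_snd {q h r : ℝ} (hr : 0 < r) {E : Set (ℝ × ℝ)}
    {S : Finset (ℝ × ℝ)} (hI : Icc q (q + h) ⊆ Prod.snd '' E)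
    (hS : E ⊆ ⋃ x ∈ S, closedBall x r) : h ≤ S.card * (2 * r) := by
  have hsub : Icc q (q + h) ⊆ ⋃ x ∈ S, closedBall x.2 r := by
    intro t ht
    obtain ⟨p, hp, rfl⟩ := hI ht
    obtain ⟨x, hx, hpx⟩ := mem_iUnion₂.1 (hS hp)
    exact mem_biUnion hx (mem_closedBall.2 ((le_max_right _ _).trans (mem_closedBall.1 hpx)))
  have hv := (MeasureTheory.measure_mono hsub (μ := MeasureTheory.volume)).trans
    (MeasureTheory.measure_biUnion_finset_le S _)
  simp only [Real.volume_Icc, Real.volume_closedBall, Finset.sum_const, nsmul_eq_mul,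
    add_sub_cancel_left] at hv
  rw [← ENNReal.ofReal_natCast, ← ENNReal.ofReal_mul (by positivity)] at hv
  exact (ENNReal.ofReal_le_ofReal_iff (by positivity)).1 hv

/-- If `E` is `r`-dense in a square of side `R`, then covering `E` takes at least `(R / (4r))²`
balls. -/
lemma sq_le_card_mul_of_dense {R r : ℝ} (hR : 0 ≤ R) (hr : 0 < r) {E : Set (ℝ × ℝ)}
    {S : Finset (ℝ × ℝ)} (hd : ∀ p ∈ Ico (0 : ℝ) R ×ˢ Ico (0 : ℝ) R, ∃ z ∈ E, dist p z ≤ r)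
    (hS : E ⊆ ⋃ x ∈ S, closedBall x r) : R ^ 2 ≤ S.card * (4 * r) ^ 2 := by
  have hsub : Ico (0 : ℝ) R ×ˢ Ico (0 : ℝ) R ⊆ ⋃ x ∈ S, closedBall x (2 * r) := by
    intro p hp
    obtain ⟨z, hz, hpz⟩ := hd p hp
    obtain ⟨x, hx, hzx⟩ := mem_iUnion₂.1 (hS hz)
    refine mem_biUnion hx (mem_closedBall.2 ?_)
    linarith [dist_triangle p z x, mem_closedBall.1 hzx]
  have hv := (MeasureTheory.measure_mono hsub (μ := MeasureTheory.volume)).trans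
    (MeasureTheory.measure_biUnion_finset_le S _)
  have hball (x : ℝ × ℝ) : MeasureTheory.volume (closedBall x (2 * r)) =
      ENNReal.ofReal ((4 * r) ^ 2) := by
    rw [← closedBall_prod_same, MeasureTheory.Measure.volume_eq_prod,
      MeasureTheory.Measure.prod_prod, Real.volume_closedBall, Real.volume_closedBall,
      ← ENNReal.ofReal_mul (by positivity)]
    ring_nf
  simp only [hball, Finset.sum_const, nsmul_eq_mul] at hv
  rw [MeasureTheory.Measure.volume_eq_prod, MeasureTheory.Measure.prod_prod, Real.volume_Ico,
    sub_zero, ← ENNReal.ofReal_mul hR, ← ENNReal.ofReal_natCast,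
    ← ENNReal.ofReal_mul (by positivity)] at hv
  rw [sq R]
  exact (ENNReal.ofReal_le_ofReal_iff (by positivity)).1 hv

end Covers

section Growth

lemma le_of_mul_rpow_le {A B s t : ℝ} (hA : 0 < A)
    (h : ∀ k : ℕ, 1 ≤ k → A * ((4 / 3 : ℝ) ^ k) ^ s ≤ B * ((4 / 3 : ℝ) ^ k) ^ t) : s ≤ t := by
  by_contra! hlt
  have hT : Tendsto (fun k : ℕ => ((4 / 3 : ℝ) ^ k) ^ (s - t)) atTop atTop :=
    (tendsto_rpow_atTop (sub_pos.2 hlt)).comp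
      (tendsto_pow_atTop_atTop_of_one_lt (by norm_num))
  obtain ⟨k, hk, hk1⟩ := ((hT.eventually_gt_atTop (B / A)).and (eventually_ge_atTop 1)).exists
  have hρ : (0 : ℝ) < (4 / 3) ^ k := by positivity
  have h' := h k hk1
  rw [Real.rpow_sub hρ, div_lt_div_iff₀ hA (by positivity)] at hk
  linarith

lemma rpow_three_halves {x : ℝ} (hx : 0 ≤ x) : x ^ (3 / 2 : ℝ) = x * √x := by
  rw [show (3 / 2 : ℝ) = 1 + 1 / 2 by norm_num, Real.rpow_add_of_nonneg hx (by norm_num)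
    (by norm_num), Real.rpow_one, Real.sqrt_eq_rpow]

/-- A covering number comparable to `r ^ (-3/2)` has logarithmic growth rate `3/2`. -/
lemma tendsto_log_div_log_three_halves {N : ℝ → ℝ} {c C : ℝ} (hc : 0 < c)
    (hlow : ∀ r, 0 < r → r ≤ 1 → c ≤ N r * (r * √r))
    (hup : ∀ r, 0 < r → r ≤ 1 → N r * (r * √r) ≤ C) :
    Tendsto (fun r => Real.log (N r) / Real.log (1 / r)) (𝓝[>] 0) (𝓝 (3 / 2)) := by
  have hL : Tendsto (fun r : ℝ => Real.log (1 / r)) (𝓝[>] 0) atTop := by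
    simp only [one_div]
    exact Real.tendsto_log_atTop.comp tendsto_inv_nhdsGT_zero
  have hlim (a : ℝ) : Tendsto (fun r : ℝ => a / Real.log (1 / r) + 3 / 2) (𝓝[>] 0)
      (𝓝 (3 / 2)) := by
    simpa using (hL.const_div_atTop a).add_const (3 / 2 : ℝ)
  have hev : ∀ᶠ r : ℝ in 𝓝[>] 0, 0 < r ∧ r < 1 := Ioo_mem_nhdsGT one_pos
  have hlog {r : ℝ} (hr : 0 < r) (hr1 : r < 1) : 0 < Real.log (1 / r) ∧
      Real.log (N r * (r * √r)) = Real.log (N r) - 3 / 2 * Real.log (1 / r) := by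
    have hN : 0 < N r := by
      have := hlow r hr hr1.le
      exact pos_of_mul_pos_left (hc.trans_le this) (by positivity)
    refine ⟨Real.log_pos ((one_lt_div hr).2 hr1), ?_⟩
    rw [Real.log_mul hN.ne' (by positivity), Real.log_mul hr.ne' (by positivity),
      Real.log_sqrt hr.le, one_div, Real.log_inv]
    ring
  refine tendsto_of_tendsto_of_tendsto_of_le_of_le' (hlim (Real.log c)) (hlim (Real.log C)) ?_ ?_
  · filter_upwards [hev] with r ⟨hr, hr1⟩
    obtain ⟨hp, he⟩ := hlog hr hr1
    rw [le_div_iff₀ hp, add_mul, div_mul_cancel₀ _ hp.ne']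
    have := Real.log_le_log hc (hlow r hr hr1.le)
    linarith
  · filter_upwards [hev] with r ⟨hr, hr1⟩
    obtain ⟨hp, he⟩ := hlog hr hr1
    rw [div_le_iff₀ hp, add_mul, div_mul_cancel₀ _ hp.ne']
    have := Real.log_le_log (hc.trans_le (hlow r hr hr1.le)) (hup r hr hr1.le)
    linarith

end Growth

lemma Real.ofDigits_eq_succ {b : ℕ} (a : ℕ → Fin b) :
    Real.ofDigits a = (Real.ofDigits (fun i => a (i + 1)) + a 0) / b := by
  rw [Real.ofDigits_eq_sum_add_ofDigits a 1]
  simp [Real.ofDigitsTerm]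
  ring

/-- Admissible digit pairs `(x, y)`. At the vertex `false` the bottom row is full and the other two
rows contain only the column `0`; at the vertex `true` every row consists of the columns `2, 3`. -/
def carpetDigit (v : Bool) (x : Fin 4) (y : Fin 3) : Bool :=
  if v then decide (2 ≤ x) else decide (y = 0 ∨ x = 0)

/-- The self-affine carpet with the digit pairs at `v`. -/
def carpet (v : Bool) : Set (ℝ × ℝ) :=
  (fun p : (ℕ → Fin 4) × (ℕ → Fin 3) => (Real.ofDigits p.1, Real.ofDigits p.2)) ''
    {p | ∀ i, carpetDigit v (p.1 i) (p.2 i) = true}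

lemma isCompact_carpet (v : Bool) : IsCompact (carpet v) := by
  refine IsCompact.image (IsClosed.isCompact ?_) ?_
  · rw [ofPred_forall]
    refine isClosed_iInter fun i => ?_
    have hc : Continuous fun p : (ℕ → Fin 4) × (ℕ → Fin 3) => carpetDigit v (p.1 i) (p.2 i) :=
      (continuous_of_discreteTopology (f := fun q : Fin 4 × Fin 3 => carpetDigit v q.1 q.2)).comp
        (by fun_prop : Continuous fun p : (ℕ → Fin 4) × (ℕ → Fin 3) => (p.1 i, p.2 i))
    exact isClosed_eq hc continuous_const
  · exact (Real.continuous_ofDigits.comp continuous_fst).prodMk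
      (Real.continuous_ofDigits.comp continuous_snd)

lemma carpet_subset_unitSquare (v : Bool) : carpet v ⊆ Icc (0 : ℝ) 1 ×ˢ Icc (0 : ℝ) 1 := by
  rintro _ ⟨p, -, rfl⟩
  exact ⟨⟨Real.ofDigits_nonneg _, Real.ofDigits_le_one _⟩,
    ⟨Real.ofDigits_nonneg _, Real.ofDigits_le_one _⟩⟩

lemma mem_carpet_iff {v : Bool} {p : ℝ × ℝ} : p ∈ carpet v ↔ ∃ (i : Fin 4) (j : Fin 3),
    carpetDigit v i j = true ∧ ∃ q ∈ carpet v, p = ((q.1 + i) / 4, (q.2 + j) / 3) := by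
  constructor
  · rintro ⟨⟨x, y⟩, h, rfl⟩
    refine ⟨x 0, y 0, h 0, _, ⟨(fun i => x (i + 1), fun i => y (i + 1)), fun i => h (i + 1), rfl⟩,
      ?_⟩
    ext
    · exact_mod_cast Real.ofDigits_eq_succ x
    · exact_mod_cast Real.ofDigits_eq_succ y
  · rintro ⟨i, j, hij, _, ⟨⟨x, y⟩, h, rfl⟩, rfl⟩
    refine ⟨(fun k => Nat.casesOn k i x, fun k => Nat.casesOn k j y), ?_, ?_⟩
    · rintro (_ | k)
      exacts [hij, h k]
    · ext
      · exact_mod_cast Real.ofDigits_eq_succ (fun k => Nat.casesOn k i x : ℕ → Fin 4)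
      · exact_mod_cast Real.ofDigits_eq_succ (fun k => Nat.casesOn k j y : ℕ → Fin 3)

lemma exists_carpetDigit (v : Bool) (j : Fin 3) : ∃ i, carpetDigit v i j = true := by
  revert v j; decide

/-- Every row is nonempty, so the carpets project onto the unit interval. -/
lemma exists_mem_carpet_snd (v : Bool) {t : ℝ} (ht : t ∈ Icc (0 : ℝ) 1) :
    ∃ p ∈ carpet v, p.2 = t := by
  obtain ⟨y, -, rfl⟩ := Real.ofDigits_SurjOn (b := 3) (by norm_num) ht
  choose f hf using exists_carpetDigit v
  exact ⟨_, ⟨(fun i => f (y i), y), fun i => hf _, rfl⟩, rfl⟩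

lemma zero_mem_carpet_false {t : ℝ} (ht : t ∈ Icc (0 : ℝ) 1) : ((0 : ℝ), t) ∈ carpet false := by
  obtain ⟨y, -, rfl⟩ := Real.ofDigits_SurjOn (b := 3) (by norm_num) ht
  refine ⟨(fun _ => 0, y), fun i => by simp [carpetDigit], ?_⟩
  simp [Real.ofDigits, Real.ofDigitsTerm]

/-- Around each of its points a carpet contains a `4⁻ᵏ`-thin set projecting onto a triadic interval
of length `3⁻ᵏ`. -/
lemma exists_column (v : Bool) (k : ℕ) : ∀ p ∈ carpet v, ∃ q : ℝ,
    p.2 ∈ Icc q (q + ((3 : ℝ) ^ k)⁻¹) ∧ ∀ t ∈ Icc q (q + ((3 : ℝ) ^ k)⁻¹),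
      ∃ z ∈ carpet v, z.2 = t ∧ |z.1 - p.1| ≤ ((4 : ℝ) ^ k)⁻¹ := by
  induction k with
  | zero =>
    intro p hp
    have hp' := carpet_subset_unitSquare v hp
    refine ⟨0, by simpa using hp'.2, fun t ht => ?_⟩
    obtain ⟨z, hz, hzt⟩ := exists_mem_carpet_snd v (t := t) (by simpa using ht)
    have hz' := carpet_subset_unitSquare v hz
    refine ⟨z, hz, hzt, ?_⟩
    rw [pow_zero, inv_one, abs_le]
    constructor <;> linarith [hz'.1.1, hz'.1.2, hp'.1.1, hp'.1.2]
  | succ k ih =>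
    intro p hp
    obtain ⟨i, j, hij, p', hp', rfl⟩ := mem_carpet_iff.1 hp
    obtain ⟨q, hpq, hq⟩ := ih p' hp'
    have h3 : ((3 : ℝ) ^ (k + 1))⁻¹ = ((3 : ℝ) ^ k)⁻¹ / 3 := by rw [pow_succ, mul_inv]; ring
    have h4 : ((4 : ℝ) ^ (k + 1))⁻¹ = ((4 : ℝ) ^ k)⁻¹ / 4 := by rw [pow_succ, mul_inv]; ring
    rw [h3, h4]
    refine ⟨(q + j) / 3, ⟨by linarith [hpq.1], by linarith [hpq.2]⟩, fun t ht => ?_⟩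
    obtain ⟨z, hz, hzt, hzp⟩ := hq (3 * t - j) ⟨by linarith [ht.1], by linarith [ht.2]⟩
    refine ⟨_, mem_carpet_iff.2 ⟨i, j, hij, z, hz, rfl⟩, ?_, ?_⟩
    · rw [hzt]; ring
    · rw [abs_le] at hzp ⊢
      constructor <;> linarith [hzp.1, hzp.2]

/-- Every carpet is covered by `6ˡ` rectangles of size `4⁻ˡ × 3⁻ˡ`. -/
lemma exists_rectangles (v : Bool) (l : ℕ) : ∃ T : Finset (ℝ × ℝ), T.card ≤ 6 ^ l ∧
    carpet v ⊆ ⋃ q ∈ T, Icc q.1 (q.1 + ((4 : ℝ) ^ l)⁻¹) ×ˢ Icc q.2 (q.2 + ((3 : ℝ) ^ l)⁻¹) := by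
  induction l with
  | zero =>
    exact ⟨{(0, 0)}, by simp, by simpa using carpet_subset_unitSquare v⟩
  | succ l ih =>
    obtain ⟨T, hT, hc⟩ := ih
    let D : Finset (Fin 4 × Fin 3) := Finset.univ.filter fun e => carpetDigit v e.1 e.2 = true
    have hD : D.card = 6 := by
      have : ∀ w : Bool, (Finset.univ.filter
        fun e : Fin 4 × Fin 3 => carpetDigit w e.1 e.2 = true).card = 6 := by decide
      simpa [D] using this v
    refine ⟨(D ×ˢ T).image fun z => ((z.2.1 + z.1.1) / 4, (z.2.2 + z.1.2) / 3), ?_, ?_⟩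
    · refine Finset.card_image_le.trans ?_
      rw [Finset.card_product, hD, pow_succ']
      gcongr
    · intro p hp
      obtain ⟨i, j, hij, p', hp', rfl⟩ := mem_carpet_iff.1 hp
      obtain ⟨q, hq, hpq⟩ := mem_iUnion₂.1 (hc hp')
      refine mem_biUnion (Finset.mem_coe.2 (Finset.mem_image.2 ⟨((i, j), q),
        Finset.mk_mem_product (Finset.mem_filter.2 ⟨Finset.mem_univ _, hij⟩) hq, rfl⟩)) ?_
      have h3 : ((3 : ℝ) ^ (l + 1))⁻¹ = ((3 : ℝ) ^ l)⁻¹ / 3 := by rw [pow_succ, mul_inv]; ring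
      have h4 : ((4 : ℝ) ^ (l + 1))⁻¹ = ((4 : ℝ) ^ l)⁻¹ / 4 := by rw [pow_succ, mul_inv]; ring
      rw [h3, h4]
      obtain ⟨⟨h1, h2⟩, h5, h6⟩ := hpq
      constructor <;> constructor <;> dsimp only <;> linarith

/-- The carpets are covered by `O(r ^ (-3/2))` balls of radius `r`. -/
lemma exists_cover_carpet (v : Bool) {r : ℝ} (hr : 0 < r) (hr1 : r ≤ 1) :
    ∃ S : Finset (ℝ × ℝ), (S.card : ℝ) * (r * √r) ≤ 20 ∧
      carpet v ⊆ ⋃ x ∈ S, closedBall x r := by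
  obtain ⟨n, hn, hn'⟩ := exists_nat_pow_near_of_lt_one hr hr1
    (by norm_num : (0 : ℝ) < 1 / 4) (by norm_num)
  obtain ⟨T, hT, hc⟩ := exists_rectangles v (n + 1)
  set w : ℝ := ((4 : ℝ) ^ (n + 1))⁻¹ with hw
  set h : ℝ := ((3 : ℝ) ^ (n + 1))⁻¹ with hh
  have hw0 : 0 < w := by positivity
  have hh0 : 0 < h := by positivity
  have hwr : w ≤ r := by
    have := hn.le
    rwa [one_div, inv_pow] at this
  have hrw : r ≤ 4 * w := by
    rw [one_div, inv_pow] at hn'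
    rw [hw, pow_succ, mul_inv]
    linarith
  have hwh : w ≤ h := by
    rw [hw, hh]
    gcongr
    norm_num
  choose F hF hFc using fun q : ℝ × ℝ =>
    exists_cover_rectangle (a := q.1) (b := q.2) hr hw0.le hh0.le
  refine ⟨T.biUnion F, ?_, fun p hp => ?_⟩
  · have hone : (w / r + 1) * (h / r + 1) ≤ 10 * h / r := by
      have h1 : w / r ≤ 1 := (div_le_one hr).2 hwr
      have h2 : 1 ≤ 4 * h / r := (one_le_div hr).2 (by linarith)
      have h3 : 10 * h / r = 2 * (h / r + 4 * h / r) := by ring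
      rw [h3]
      gcongr
      linarith
    have hcard : ((T.biUnion F).card : ℝ) ≤ 6 ^ (n + 1) * (10 * h / r) := by
      calc ((T.biUnion F).card : ℝ) ≤ ∑ q ∈ T, ((F q).card : ℝ) := by
            exact_mod_cast Finset.card_biUnion_le
        _ ≤ ∑ q ∈ T, 10 * h / r := Finset.sum_le_sum fun q _ => (hF q).trans hone
        _ = T.card * (10 * h / r) := by rw [Finset.sum_const, nsmul_eq_mul]
        _ ≤ _ := by
            gcongr
            exact_mod_cast hT
    have h2 : (2 : ℝ) ^ (n + 1) * √r ≤ 2 := by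
      rw [← sq_le_sq₀ (by positivity) (by norm_num), mul_pow, Real.sq_sqrt hr.le, ← pow_mul,
        mul_comm (n + 1), pow_mul]
      calc ((2 : ℝ) ^ 2) ^ (n + 1) * r ≤ ((2 : ℝ) ^ 2) ^ (n + 1) * (4 * w) := by gcongr
        _ = 2 ^ 2 := by
          rw [hw]
          norm_num
          field_simp
    have h6 : (6 : ℝ) ^ (n + 1) * h = 2 ^ (n + 1) := by
      rw [hh, show (6 : ℝ) = 2 * 3 by norm_num, mul_pow]
      field_simp
    calc ((T.biUnion F).card : ℝ) * (r * √r) ≤ 6 ^ (n + 1) * (10 * h / r) * (r * √r) := by gcongr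
      _ = 10 * ((6 ^ (n + 1) * h) * √r) := by field_simp
      _ ≤ 20 := by rw [h6]; linarith
  · obtain ⟨q, hq, hpq⟩ := mem_iUnion₂.1 (hc hp)
    obtain ⟨x, hx, hpx⟩ := mem_iUnion₂.1 (hFc q hpq)
    exact mem_biUnion (Finset.mem_coe.2 (Finset.mem_biUnion.2 ⟨q, hq, hx⟩)) hpx

/-- The full bottom row of the carpet at `false` produces `4⁻ᵏ`-dense squares of side `3⁻ᵏ`. -/
lemma grid_mem_carpet_false (k : ℕ) : ∀ j : ℕ, j < 4 ^ k → ∀ t ∈ Icc (0 : ℝ) 1,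
    ((j : ℝ) / 4 ^ k, t / 3 ^ k) ∈ carpet false := by
  induction k with
  | zero =>
    intro j hj t ht
    obtain rfl : j = 0 := by simpa using hj
    simpa using zero_mem_carpet_false ht
  | succ k ih =>
    intro j hj t ht
    have hd : j / 4 ^ k < 4 := Nat.div_lt_of_lt_mul (by rwa [← pow_succ])
    refine mem_carpet_iff.2 ⟨⟨j / 4 ^ k, hd⟩, 0, by simp [carpetDigit], _,
      ih (j % 4 ^ k) (Nat.mod_lt _ (by positivity)) t ht, ?_⟩
    have hj' : (j : ℝ) = (4 : ℝ) ^ k * (j / 4 ^ k : ℕ) + (j % 4 ^ k : ℕ) := by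
      exact_mod_cast (Nat.div_add_mod j (4 ^ k)).symm
    ext
    · dsimp only
      rw [hj']
      field_simp
      ring
    · dsimp only
      simp only [Fin.val_zero, Nat.cast_zero, add_zero]
      field_simp
      ring

/-- Near the height `1/2` the carpet at `false` is confined to a thin vertical strip. -/
lemma fst_le_of_near_half (k : ℕ) : ∀ p ∈ carpet false, |p.2 - 1 / 2| < ((3 : ℝ) ^ k)⁻¹ / 2 →
    p.1 ≤ ((4 : ℝ) ^ k)⁻¹ := by
  induction k with
  | zero => exact fun p hp _ => by simpa using (carpet_subset_unitSquare _ hp).1.2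
  | succ k ih =>
    intro p hp hk
    obtain ⟨i, j, hij, q, hq, rfl⟩ := mem_carpet_iff.1 hp
    have hq2 := (carpet_subset_unitSquare _ hq).2
    have h3 : ((3 : ℝ) ^ (k + 1))⁻¹ = ((3 : ℝ) ^ k)⁻¹ / 3 := by rw [pow_succ, mul_inv]; ring
    have h4 : ((4 : ℝ) ^ (k + 1))⁻¹ = ((4 : ℝ) ^ k)⁻¹ / 4 := by rw [pow_succ, mul_inv]; ring
    have hle : ((3 : ℝ) ^ k)⁻¹ ≤ 1 := inv_le_one_of_one_le₀ (one_le_pow₀ (by norm_num))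
    rw [h3, abs_lt] at hk
    dsimp only at hk ⊢
    obtain rfl : j = 1 := by
      fin_cases j
      · simp at hk
        linarith [hq2.2]
      · rfl
      · simp at hk
        linarith [hq2.1]
    obtain rfl : i = 0 := by simpa [carpetDigit] using hij
    have := ih q hq (by
      rw [abs_lt]
      simp only [Fin.val_one, Nat.cast_one] at hk
      constructor <;> linarith [hk.1, hk.2])
    rw [h4]
    simp only [Fin.val_zero, Nat.cast_zero, add_zero]
    linarith

lemma half_le_of_mem_carpet_true {p : ℝ × ℝ} (hp : p ∈ carpet true) : 1 / 2 ≤ p.1 := by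
  obtain ⟨i, j, hij, q, hq, rfl⟩ := mem_carpet_iff.1 hp
  have hi : (2 : ℝ) ≤ (i : ℕ) := by
    simp only [carpetDigit, if_true, decide_eq_true_eq] at hij
    exact_mod_cast hij
  have := (carpet_subset_unitSquare _ hq).1.1
  dsimp only
  linarith

section CantorMeasure

open MeasureTheory

/-- The digit map `0, 1 ↦ 2, 3`. -/
def shiftDigit (d : Fin 2) : Fin 4 := ⟨d + 2, by omega⟩

/-- The point of the Cantor set with base-`4` digits `2, 3` obtained from the binary digits of
`t`. -/
def cantorPoint (t : ℝ) : ℝ := Real.ofDigits fun i => shiftDigit (Real.digits t 2 i)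

lemma measurable_cantorPoint : Measurable cantorPoint := by
  refine Real.continuous_ofDigits.measurable.comp (measurable_pi_iff.2 fun i => ?_)
  refine (measurable_of_countable fun k : ℕ => shiftDigit (Fin.ofNat 2 k)).comp ?_
  exact Nat.measurable_floor.comp (measurable_id.mul_const _)

lemma sq_ofDigits_sub_le (d d' : ℕ → Fin 2) : (Real.ofDigits d - Real.ofDigits d') ^ 2 ≤
    9 * |Real.ofDigits (fun i => shiftDigit (d i)) -
      Real.ofDigits (fun i => shiftDigit (d' i))| := by
  by_cases hd : d = d'
  · simp [hd]
  have hex : ∃ n, d n ≠ d' n := Function.ne_iff.1 hd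
  obtain ⟨n, hn, hlt⟩ : ∃ n, d n ≠ d' n ∧ ∀ i < n, d i = d' i :=
    ⟨Nat.find hex, Nat.find_spec hex, fun i hi => not_not.1 (Nat.find_min hex hi)⟩
  have hL : (Real.ofDigits d - Real.ofDigits d') ^ 2 ≤ ((4 : ℝ) ^ n)⁻¹ := by
    have h := Real.abs_ofDigits_sub_ofDigits_le hlt
    rw [← sq_abs]
    calc |Real.ofDigits d - Real.ofDigits d'| ^ 2 ≤ ((((2 : ℕ) : ℝ) ^ n)⁻¹) ^ 2 := by gcongr
      _ = ((4 : ℝ) ^ n)⁻¹ := by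
        rw [inv_pow, ← pow_mul, mul_comm, pow_mul]
        norm_num
  have hsep (a a' : ℕ → Fin 2) (h : a 0 = 0) (h' : a' 0 = 1) :
      1 / 8 ≤ Real.ofDigits (fun i => shiftDigit (a' i)) -
        Real.ofDigits (fun i => shiftDigit (a i)) := by
    rw [Real.ofDigits_eq_succ, Real.ofDigits_eq_succ (fun i => shiftDigit (a i)),
      Real.ofDigits_eq_succ (fun i => shiftDigit (a' (i + 1)))]
    have h1 := Real.ofDigits_nonneg fun i => shiftDigit (a' (i + 1 + 1))
    have h2 := Real.ofDigits_le_one fun i => shiftDigit (a (i + 1))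
    simp only [h, h', shiftDigit, zero_add, Fin.val_zero, Fin.val_one]
    simp only [shiftDigit] at h1 h2
    push_cast
    linarith [Nat.cast_nonneg (α := ℝ) (a' 1 : ℕ)]
  have hR : ((4 : ℝ) ^ n)⁻¹ * (1 / 8) ≤ |Real.ofDigits (fun i => shiftDigit (d i)) -
      Real.ofDigits (fun i => shiftDigit (d' i))| := by
    have hsum : ∑ i ∈ Finset.range n, Real.ofDigitsTerm (fun i => shiftDigit (d i)) i =
        ∑ i ∈ Finset.range n, Real.ofDigitsTerm (fun i => shiftDigit (d' i)) i :=
      Finset.sum_congr rfl fun i hi => by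
        simp only [Real.ofDigitsTerm, hlt i (Finset.mem_range.1 hi)]
    rw [Real.ofDigits_eq_sum_add_ofDigits _ n,
      Real.ofDigits_eq_sum_add_ofDigits (fun i => shiftDigit (d' i)) n, hsum,
      add_sub_add_left_eq_sub, ← mul_sub, abs_mul, abs_of_nonneg (by positivity)]
    refine mul_le_mul_of_nonneg_left ?_ (by positivity)
    have hcases : (d n = 0 ∧ d' n = 1) ∨ (d n = 1 ∧ d' n = 0) := by
      generalize d n = x at hn ⊢
      generalize d' n = y at hn ⊢
      revert x y
      decide
    rcases hcases with ⟨h, h'⟩ | ⟨h, h'⟩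
    · rw [abs_sub_comm]
      exact (hsep (fun i => d (i + n)) (fun i => d' (i + n)) (by simpa) (by simpa)).trans
        (le_abs_self _)
    · exact (hsep (fun i => d' (i + n)) (fun i => d (i + n)) (by simpa) (by simpa)).trans
        (le_abs_self _)
  have : (0 : ℝ) ≤ ((4 : ℝ) ^ n)⁻¹ := by positivity
  linarith

/-- The inverse of `cantorPoint` is Hölder continuous with exponent `1/2`. -/
lemma abs_sub_le_sqrt_cantorPoint {s t : ℝ} (hs : s ∈ Ico (0 : ℝ) 1) (ht : t ∈ Ico (0 : ℝ) 1) :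
    |s - t| ≤ 3 * √|cantorPoint s - cantorPoint t| := by
  have h := sq_ofDigits_sub_le (Real.digits s 2) (Real.digits t 2)
  rw [Real.ofDigits_digits (by norm_num) hs, Real.ofDigits_digits (by norm_num) ht] at h
  refine abs_le_of_sq_le_sq ?_ (by positivity)
  rw [mul_pow, Real.sq_sqrt (abs_nonneg _)]
  norm_num
  exact h

/-- The product of the Cantor measure with Lebesgue measure, carried by `carpet true`. -/
def carpetMeasure : Measure (ℝ × ℝ) :=
  (volume.restrict (Ico (0 : ℝ) 1 ×ˢ Ico (0 : ℝ) 1)).map (Prod.map cantorPoint id)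

lemma carpetMeasure_carpet_true : carpetMeasure (carpet true) = 1 := by
  rw [carpetMeasure, Measure.map_apply (measurable_cantorPoint.prodMap measurable_id)
    (isCompact_carpet true).measurableSet, Measure.restrict_apply' (measurableSet_Ico.prod
    measurableSet_Ico), inter_eq_right.2, Measure.volume_eq_prod, Measure.prod_prod,
    Real.volume_Ico]
  · simp
  · rintro ⟨s, t⟩ ⟨-, ht⟩
    refine ⟨(fun i => shiftDigit (Real.digits s 2 i), Real.digits t 3), fun i => ?_, ?_⟩
    · simp only [carpetDigit, if_true, decide_eq_true_eq]
      exact Nat.le_add_left 2 _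
    · exact Prod.ext rfl (Real.ofDigits_digits (by norm_num) ht)

lemma carpetMeasure_le_of_dist_le {s : Set (ℝ × ℝ)} {δ : ℝ} (hs : MeasurableSet s)
    (h : ∀ p ∈ s, ∀ q ∈ s, dist p q ≤ δ) :
    carpetMeasure s ≤ ENNReal.ofReal (3 * (δ * √δ)) := by
  have hsub : Prod.map cantorPoint id ⁻¹' s ∩ Ico (0 : ℝ) 1 ×ˢ Ico (0 : ℝ) 1 ⊆
      (Ico (0 : ℝ) 1 ∩ cantorPoint ⁻¹' (Prod.fst '' s)) ×ˢ (Prod.snd '' s) :=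
    fun p hp => ⟨⟨hp.2.1, _, hp.1, rfl⟩, _, hp.1, rfl⟩
  rw [carpetMeasure, Measure.map_apply (measurable_cantorPoint.prodMap measurable_id) hs,
    Measure.restrict_apply' (measurableSet_Ico.prod measurableSet_Ico)]
  refine (measure_mono hsub).trans ?_
  rw [Measure.volume_eq_prod, Measure.prod_prod,
    show 3 * (δ * √δ) = (3 * √δ) * δ by ring, ENNReal.ofReal_mul (by positivity)]
  gcongr
  · refine (Real.volume_le_diam _).trans (ediam_le fun t ht u hu => ?_)
    obtain ⟨ht, p, hp, hpt⟩ := ht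
    obtain ⟨hu, q, hq, hqu⟩ := hu
    rw [edist_dist, Real.dist_eq]
    refine ENNReal.ofReal_le_ofReal ((abs_sub_le_sqrt_cantorPoint ht hu).trans ?_)
    rw [← hpt, ← hqu, ← Real.dist_eq]
    gcongr
    exact (le_max_left _ _).trans (h p hp q hq)
  · refine (Real.volume_le_diam _).trans (ediam_le ?_)
    rintro _ ⟨p, hp, rfl⟩ _ ⟨q, hq, rfl⟩
    rw [edist_dist]
    exact ENNReal.ofReal_le_ofReal ((le_max_right _ _).trans (h p hp q hq))

lemma carpetMeasure_le_ediam (s : Set (ℝ × ℝ)) :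
    carpetMeasure s ≤ 3 * ediam s ^ (3 / 2 : ℝ) := by
  by_cases htop : ediam s = ⊤
  · simp [htop]
  refine (measure_mono subset_closure).trans ?_
  have hdist : ∀ p ∈ closure s, ∀ q ∈ closure s, dist p q ≤ (ediam s).toReal := by
    intro p hp q hq
    rw [dist_edist]
    refine ENNReal.toReal_mono htop ?_
    rw [← ediam_closure]
    exact edist_le_ediam_of_mem hp hq
  refine (carpetMeasure_le_of_dist_le isClosed_closure.measurableSet
    hdist).trans_eq ?_
  rw [← rpow_three_halves ENNReal.toReal_nonneg, ENNReal.ofReal_mul (by norm_num),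
    ← ENNReal.ofReal_rpow_of_nonneg ENNReal.toReal_nonneg (by norm_num), ENNReal.ofReal_toReal htop]
  norm_num

lemma le_card_mul_of_carpet_true_subset {r : ℝ} (hr : 0 < r) {S : Finset (ℝ × ℝ)}
    (hS : carpet true ⊆ ⋃ x ∈ S, closedBall x r) : 1 / 9 ≤ S.card * (r * √r) := by
  have hv := (measure_mono hS (μ := carpetMeasure)).trans (measure_biUnion_finset_le S _)
  rw [carpetMeasure_carpet_true] at hv
  have hball (x : ℝ × ℝ) : carpetMeasure (closedBall x r) ≤
      ENNReal.ofReal (3 * (2 * r * √(2 * r))) := by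
    refine carpetMeasure_le_of_dist_le isClosed_closedBall.measurableSet ?_
    intro p hp q hq
    linarith [dist_triangle_right p q x, mem_closedBall.1 hp, mem_closedBall.1 hq]
  replace hv := hv.trans (Finset.sum_le_sum fun x _ => hball x)
  rw [Finset.sum_const, nsmul_eq_mul, ← ENNReal.ofReal_natCast,
    ← ENNReal.ofReal_mul (by positivity), ENNReal.one_le_ofReal, Real.sqrt_mul (by norm_num)] at hv
  have h2 : √2 ≤ 3 / 2 := Real.sqrt_le_iff.2 (by norm_num)
  have h3 : √2 * (6 * (S.card * (r * √r))) ≤ 3 / 2 * (6 * (S.card * (r * √r))) := by gcongr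
  linarith

lemma three_halves_le_dimH_carpet_true : ENNReal.ofReal (3 / 2) ≤ dimH (carpet true) := by
  refine le_dimH_of_hausdorffMeasure_ne_zero (d := Real.toNNReal (3 / 2)) fun h0 => ?_
  rw [Real.coe_toNNReal _ (by norm_num)] at h0
  have hle : (3 : ENNReal)⁻¹ • carpetMeasure ≤ Measure.hausdorffMeasure (3 / 2) := by
    refine Measure.le_hausdorffMeasure _ _ 1 one_pos fun s _ => ?_
    rw [Measure.smul_apply, smul_eq_mul, mul_comm, ← div_eq_mul_inv]
    exact ENNReal.div_le_of_le_mul' (carpetMeasure_le_ediam s)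
  have := hle (carpet true)
  rw [h0, Measure.smul_apply, carpetMeasure_carpet_true] at this
  simp at this

end CantorMeasure

lemma dimH_le_three_halves_of_cover {E : Set (ℝ × ℝ)} {C : ℝ}
    (h : ∀ r : ℝ, 0 < r → r ≤ 1 → ∃ S : Finset (ℝ × ℝ), (S.card : ℝ) * (r * √r) ≤ C ∧
      E ⊆ ⋃ x ∈ S, closedBall x r) : dimH E ≤ ENNReal.ofReal (3 / 2) := by
  refine dimH_le_of_hausdorffMeasure_ne_top (d := Real.toNNReal (3 / 2)) ?_
  rw [Real.coe_toNNReal _ (by norm_num)]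
  have hpos (n : ℕ) : (0 : ℝ) < (1 / 2) ^ n := by positivity
  choose S hS hc using fun n : ℕ => h ((1 / 2) ^ n) (hpos n) (pow_le_one₀ (by norm_num)
    (by norm_num))
  have hdiam (n : ℕ) (x : ℝ × ℝ) : ediam (closedBall x ((1 / 2) ^ n)) ≤
      ENNReal.ofReal (2 * (1 / 2) ^ n) := by
    refine ediam_le fun p hp q hq => ?_
    rw [edist_dist]
    exact ENNReal.ofReal_le_ofReal (by
      linarith [dist_triangle_right p q x, mem_closedBall.1 hp, mem_closedBall.1 hq])
  refine ne_top_of_le_ne_top (b := ENNReal.ofReal (2 * √2 * C)) ENNReal.ofReal_ne_top ?_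
  refine (MeasureTheory.Measure.hausdorffMeasure_le_liminf_sum (ι := fun n => S n) (3 / 2) E
    (l := atTop) (fun n : ℕ => ENNReal.ofReal (2 * (1 / 2) ^ n)) ?_
    (fun n x => closedBall (x : ℝ × ℝ) ((1 / 2) ^ n)) (Eventually.of_forall fun n x => hdiam n x)
    (Eventually.of_forall fun n => by simpa [iUnion_subtype] using hc n)).trans ?_
  · rw [← ENNReal.ofReal_zero]
    refine ENNReal.tendsto_ofReal ?_
    simpa using (tendsto_pow_atTop_nhds_zero_of_lt_one (by norm_num : (0 : ℝ) ≤ 1 / 2)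
      (by norm_num)).const_mul 2
  · refine liminf_le_of_frequently_le' (Frequently.of_forall fun n => ?_)
    calc ∑ x : S n, ediam (closedBall (x : ℝ × ℝ) ((1 / 2) ^ n)) ^ (3 / 2 : ℝ)
        ≤ ∑ _x : S n, ENNReal.ofReal (2 * (1 / 2) ^ n) ^ (3 / 2 : ℝ) := by
          gcongr with x
          exact hdiam n x
      _ = ENNReal.ofReal (2 * √2 * ((S n).card * ((1 / 2) ^ n * √((1 / 2) ^ n)))) := by
          rw [Finset.sum_const, nsmul_eq_mul, Finset.card_univ, Fintype.card_coe,
            ENNReal.ofReal_rpow_of_nonneg (by positivity) (by norm_num),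
            rpow_three_halves (by positivity), Real.sqrt_mul (by norm_num),
            ← ENNReal.ofReal_natCast, ← ENNReal.ofReal_mul (by positivity)]
          ring_nf
      _ ≤ ENNReal.ofReal (2 * √2 * C) := by
          gcongr
          exact hS n

/-- The non-irreducible `(×3,×4)`-carpet family consisting of the two carpets `carpet false` and
`carpet true`. -/
def twoCarpets : GDBMCarpet where
  m := 3
  n := 4
  hm := by norm_num
  hmn := by norm_num
  V := Bool
  E := {e : Bool × Fin 4 × Fin 3 // carpetDigit e.1 e.2.1 e.2.2 = true}
  fintypeV := inferInstance
  fintypeE := inferInstance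
  decV := inferInstance
  decE := inferInstance
  src e := e.1.1
  tgt e := e.1.1
  xd e := e.1.2.1
  yd e := e.1.2.2
  src_surj v := by
    obtain ⟨i, hi⟩ := exists_carpetDigit v 0
    exact ⟨⟨(v, i, 0), hi⟩, rfl⟩
  X := carpet
  X_nonempty v := (exists_mem_carpet_snd v ⟨le_rfl, zero_le_one⟩).imp fun _ h => h.1
  X_compact := isCompact_carpet
  X_subset := carpet_subset_unitSquare
  X_invariant v := by
    ext p
    rw [mem_carpet_iff]
    constructor
    · rintro ⟨i, j, hij, q, hq, rfl⟩
      exact mem_biUnion (x := ⟨(v, i, j), hij⟩) rfl ⟨q, hq, by simp⟩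
    · intro hp
      obtain ⟨⟨⟨v', i, j⟩, hij⟩, rfl, q, hq, rfl⟩ := mem_iUnion₂.1 hp
      exact ⟨i, j, hij, q, hq, by simp⟩

lemma not_graphIrreducible_twoCarpets : ¬ twoCarpets.GraphIrreducible := by
  intro h
  obtain ⟨k, hk, hpos⟩ := h (false : Bool) (true : Bool)
  have hdiag : twoCarpets.adjMat = Matrix.diagonal fun v => twoCarpets.adjMat v v := by
    ext v w
    by_cases hvw : v = w
    · simp [hvw]
    · rw [Matrix.diagonal_apply_ne _ hvw, GDBMCarpet.adjMat, Finset.card_eq_zero,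
        Finset.filter_eq_empty_iff]
      rintro e - ⟨h1, h2⟩
      exact hvw (h1.symm.trans h2)
  rw [hdiag, Matrix.diagonal_pow] at hpos
  exact (hpos.trans_eq (Matrix.diagonal_apply_ne _ Bool.false_ne_true)).false

/-- The union of the two carpets. -/
def carpetUnion : Set (ℝ × ℝ) := carpet false ∪ carpet true

lemma Xunion_twoCarpets : twoCarpets.Xunion = carpetUnion := by
  rw [carpetUnion, union_comm, union_eq_iUnion]
  exact iUnion_congr fun v => by cases v <;> rfl

lemma mem_carpetUnion {p : ℝ × ℝ} : p ∈ carpetUnion ↔ ∃ v, p ∈ carpet v := by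
  simp [carpetUnion]

lemma carpetUnion_subset_unitSquare : carpetUnion ⊆ Icc (0 : ℝ) 1 ×ˢ Icc (0 : ℝ) 1 :=
  union_subset (carpet_subset_unitSquare _) (carpet_subset_unitSquare _)

lemma exists_cover_carpetUnion {r : ℝ} (hr : 0 < r) (hr1 : r ≤ 1) :
    ∃ S : Finset (ℝ × ℝ), (S.card : ℝ) * (r * √r) ≤ 40 ∧
      carpetUnion ⊆ ⋃ x ∈ S, closedBall x r := by
  obtain ⟨S, hS, hSc⟩ := exists_cover_carpet false hr hr1
  obtain ⟨T, hT, hTc⟩ := exists_cover_carpet true hr hr1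
  refine ⟨S ∪ T, ?_, ?_⟩
  · have hcard : ((S ∪ T).card : ℝ) ≤ S.card + T.card := by
      exact_mod_cast Finset.card_union_le S T
    have : 0 ≤ r * √r := by positivity
    nlinarith
  · rw [Finset.set_biUnion_union]
    exact union_subset_union hSc hTc

lemma dimH_carpetUnion : dimH carpetUnion = ENNReal.ofReal (3 / 2) :=
  le_antisymm (dimH_le_three_halves_of_cover fun _ => exists_cover_carpetUnion)
    (three_halves_le_dimH_carpet_true.trans (dimH_mono subset_union_right))

lemma tendsto_boxCounting_carpetUnion :
    Tendsto (fun r : ℝ => Real.log (coverNum r carpetUnion) / Real.log (1 / r)) (𝓝[>] 0)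
      (𝓝 (3 / 2)) := by
  refine tendsto_log_div_log_three_halves (N := fun r => (coverNum r carpetUnion : ℝ))
    (c := 1 / 9) (C := 40) (by norm_num) (fun r hr _ => ?_) fun r hr hr1 => ?_
  · obtain ⟨S, hS, hc⟩ := exists_card_eq_coverNum hr carpetUnion_subset_unitSquare
    rw [← hS]
    exact le_card_mul_of_carpet_true_subset hr (subset_union_right.trans hc)
  · obtain ⟨S, hS, hc⟩ := exists_cover_carpetUnion hr hr1
    refine le_trans ?_ hS
    gcongr
    exact coverNum_le_card S hc

lemma coverNum_inter_ball_le (E : Set (ℝ × ℝ)) (x : ℝ × ℝ) {r R : ℝ} (hr : 0 < r) (hrR : r < R) :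
    (coverNum r (E ∩ ball x R) : ℝ) ≤ 9 * (R / r) ^ (2 : ℝ) := by
  have hsub : E ∩ ball x R ⊆ Icc (x.1 - R) (x.1 - R + 2 * R) ×ˢ
      Icc (x.2 - R) (x.2 - R + 2 * R) := by
    rintro p ⟨-, hp⟩
    rw [mem_ball, Prod.dist_eq, max_lt_iff, Real.dist_eq, Real.dist_eq, abs_lt, abs_lt] at hp
    obtain ⟨⟨h1, h2⟩, h3, h4⟩ := hp
    constructor <;> constructor <;> linarith
  refine (coverNum_rectangle_le hr (by linarith) (by linarith) hsub).trans ?_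
  have h1 : 1 ≤ R / r := (one_le_div hr).2 hrR.le
  rw [Real.rpow_two, mul_div_assoc]
  nlinarith

/-- The scales `3⁻ᵏ` and `4⁻ᵏ` have ratio `(4/3)ᵏ`. -/
lemma scale_ratio (k : ℕ) : ((3 : ℝ) ^ k)⁻¹ / ((4 : ℝ) ^ k)⁻¹ = (4 / 3) ^ k := by
  rw [div_pow]
  field_simp

lemma inv_four_pow_lt_inv_three_pow {k : ℕ} (hk : 1 ≤ k) : ((4 : ℝ) ^ k)⁻¹ < ((3 : ℝ) ^ k)⁻¹ := by
  gcongr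
  norm_num

lemma inv_three_pow_le_one (k : ℕ) : ((3 : ℝ) ^ k)⁻¹ ≤ 1 :=
  inv_le_one_of_one_le₀ (one_le_pow₀ (by norm_num))

lemma dense_carpetUnion_inter_ball (k : ℕ) :
    ∀ p ∈ Ico (0 : ℝ) ((3 : ℝ) ^ k)⁻¹ ×ˢ Ico (0 : ℝ) ((3 : ℝ) ^ k)⁻¹,
      ∃ z ∈ carpetUnion ∩ ball 0 ((3 : ℝ) ^ k)⁻¹, dist p z ≤ ((4 : ℝ) ^ k)⁻¹ := by
  rintro ⟨x, y⟩ ⟨⟨hx0, hx⟩, hy0, hy⟩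
  dsimp only at hx0 hx hy0 hy
  have h4 : (0 : ℝ) < 4 ^ k := by positivity
  have h3 : (0 : ℝ) < 3 ^ k := by positivity
  have hfl := Nat.floor_le (mul_nonneg hx0 h4.le)
  have hfl' := Nat.lt_floor_add_one (x * 4 ^ k)
  have hle : (⌊x * 4 ^ k⌋₊ : ℝ) / 4 ^ k ≤ x := (div_le_iff₀ h4).2 hfl
  refine ⟨((⌊x * 4 ^ k⌋₊ : ℝ) / 4 ^ k, y), ⟨mem_carpetUnion.2 ⟨false, ?_⟩, ?_⟩, ?_⟩
  · have hj : ⌊x * 4 ^ k⌋₊ < 4 ^ k := by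
      rw [Nat.floor_lt (by positivity)]
      have : x < 1 := hx.trans_le (inv_three_pow_le_one k)
      push_cast
      nlinarith
    have := grid_mem_carpet_false k _ hj (y * 3 ^ k) ⟨by positivity, by
      rw [← one_div, lt_div_iff₀ h3] at hy
      exact hy.le⟩
    rwa [mul_div_cancel_right₀ _ h3.ne'] at this
  · rw [mem_ball, Prod.dist_eq]
    refine max_lt ?_ ?_
    · rw [Real.dist_eq]
      simp only [Prod.fst_zero, sub_zero]
      rw [abs_of_nonneg (by positivity)]
      linarith
    · simpa [Real.dist_eq, abs_of_nonneg hy0] using hy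
  · rw [Prod.dist_eq, dist_self, Real.dist_eq]
    refine max_le ?_ (by positivity)
    rw [abs_of_nonneg (by linarith), ← one_div]
    have : x < ((⌊x * 4 ^ k⌋₊ : ℝ) + 1) / 4 ^ k := (lt_div_iff₀ h4).2 hfl'
    rw [add_div] at this
    linarith

lemma zero_mem_carpetUnion : (0 : ℝ × ℝ) ∈ carpetUnion :=
  Or.inl (zero_mem_carpet_false ⟨le_rfl, zero_le_one⟩)

lemma assouadDim_carpetUnion : assouadDim carpetUnion = 2 := by
  refine le_antisymm (csInf_le ⟨0, fun s hs => hs.1⟩ ⟨by norm_num, 9, by norm_num,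
    fun x _ r R hr hrR _ => coverNum_inter_ball_le _ x hr hrR⟩)
    (le_csInf ⟨2, by norm_num, 9, by norm_num,
      fun x _ r R hr hrR _ => coverNum_inter_ball_le _ x hr hrR⟩ ?_)
  rintro s ⟨-, C, -, h⟩
  refine le_of_mul_rpow_le (A := 1 / 16) (B := C) (by norm_num) fun k hk => ?_
  have hr : (0 : ℝ) < ((4 : ℝ) ^ k)⁻¹ := by positivity
  have hup := h 0 zero_mem_carpetUnion _ _ hr (inv_four_pow_lt_inv_three_pow hk)
    (inv_three_pow_le_one k)
  obtain ⟨S, hS, hc⟩ := exists_card_eq_coverNum hr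
    (inter_subset_left.trans carpetUnion_subset_unitSquare :
      carpetUnion ∩ ball 0 ((3 : ℝ) ^ k)⁻¹ ⊆ _)
  have hlow := sq_le_card_mul_of_dense (by positivity) hr (dense_carpetUnion_inter_ball k) hc
  rw [hS] at hlow
  rw [scale_ratio] at hup
  refine le_trans ?_ hup
  rw [Real.rpow_two, ← scale_ratio, div_pow, ← mul_div_assoc, div_le_iff₀ (by positivity)]
  linarith

lemma le_coverNum_carpetUnion_inter_ball {x : ℝ × ℝ} (hx : x ∈ carpetUnion) {r R : ℝ} (hr : 0 < r)
    (hrR : r < R) (hR : R ≤ 1) :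
    1 / 6 * (R / r) ^ (1 : ℝ) ≤ (coverNum r (carpetUnion ∩ ball x R) : ℝ) := by
  obtain ⟨v, hv⟩ := mem_carpetUnion.1 hx
  obtain ⟨n, hn, hn'⟩ := exists_nat_pow_near_of_lt_one (hr.trans hrR) hR
    (by norm_num : (0 : ℝ) < 1 / 3) (by norm_num)
  rw [one_div, inv_pow] at hn hn'
  obtain ⟨q, hxq, hq⟩ := exists_column v (n + 1) x hv
  obtain ⟨S, hS, hc⟩ := exists_card_eq_coverNum hr
    (inter_subset_left.trans carpetUnion_subset_unitSquare : carpetUnion ∩ ball x R ⊆ _)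
  have h := le_card_mul_of_Icc_subset_snd (q := q) (h := ((3 : ℝ) ^ (n + 1))⁻¹) hr
    (fun t ht => by
      obtain ⟨z, hz, hzt, hzx⟩ := hq t ht
      refine ⟨z, ⟨mem_carpetUnion.2 ⟨v, hz⟩, ?_⟩, hzt⟩
      rw [mem_ball, Prod.dist_eq, max_lt_iff, Real.dist_eq, Real.dist_eq, hzt]
      have := inv_four_pow_lt_inv_three_pow (Nat.le_add_left 1 n)
      refine ⟨by linarith, (abs_le.2 ⟨?_, ?_⟩).trans_lt hn⟩ <;>
        linarith [ht.1, ht.2, hxq.1, hxq.2]) hc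
  rw [hS, pow_succ, mul_inv] at h
  rw [Real.rpow_one, ← mul_div_assoc, div_le_iff₀ hr]
  linarith

lemma coverNum_carpetUnion_inter_ball_half_le {k : ℕ} (hk : 1 ≤ k) :
    (coverNum (((4 : ℝ) ^ k)⁻¹ / 2) (carpetUnion ∩ ball (0, 1 / 2) (((3 : ℝ) ^ k)⁻¹ / 2)) : ℝ) ≤
      9 * (4 / 3) ^ k := by
  set r : ℝ := ((4 : ℝ) ^ k)⁻¹ with hr
  set R : ℝ := ((3 : ℝ) ^ k)⁻¹ with hR
  have hr0 : 0 < r := by positivity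
  have hR0 : 0 < R := by positivity
  have hR1 : R ≤ 1 := inv_three_pow_le_one k
  have hrR : r < R := inv_four_pow_lt_inv_three_pow hk
  have hsub : carpetUnion ∩ ball (0, 1 / 2) (R / 2) ⊆
      Icc 0 (0 + r) ×ˢ Icc (1 / 2 - R / 2) (1 / 2 - R / 2 + R) := by
    rintro p ⟨hp, hb⟩
    rw [mem_ball, Prod.dist_eq, max_lt_iff, Real.dist_eq, Real.dist_eq, sub_zero] at hb
    have h2 := abs_lt.1 hb.2
    refine ⟨?_, by linarith, by linarith⟩
    rcases hp with hp | hp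
    · rw [zero_add]
      exact ⟨(carpet_subset_unitSquare _ hp).1.1, fst_le_of_near_half k p hp hb.2⟩
    · linarith [half_le_of_mem_carpet_true hp, (abs_lt.1 hb.1).2]
  refine (coverNum_rectangle_le (by positivity) hr0.le hR0.le hsub).trans ?_
  rw [← scale_ratio, ← hr, ← hR]
  have h1 : 1 ≤ R / r := (one_le_div hr0).2 hrR.le
  have h2 : r / (r / 2) = 2 := by field_simp
  have h3 : R / (r / 2) = 2 * (R / r) := by field_simp
  rw [h2, h3]
  linarith

lemma lowerDim_carpetUnion : lowerDim carpetUnion = 1 := by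
  have hone : (1 : ℝ) ∈ {s : ℝ | 0 ≤ s ∧ ∃ C : ℝ, 0 < C ∧ ∀ x ∈ carpetUnion, ∀ r R : ℝ,
      0 < r → r < R → R ≤ 1 →
      C * (R / r) ^ s ≤ (coverNum r (carpetUnion ∩ ball x R) : ℝ)} :=
    ⟨zero_le_one, 1 / 6, by norm_num, fun x hx r R => le_coverNum_carpetUnion_inter_ball hx⟩
  have hub : ∀ s ∈ {s : ℝ | 0 ≤ s ∧ ∃ C : ℝ, 0 < C ∧ ∀ x ∈ carpetUnion, ∀ r R : ℝ,
      0 < r → r < R → R ≤ 1 →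
      C * (R / r) ^ s ≤ (coverNum r (carpetUnion ∩ ball x R) : ℝ)}, s ≤ 1 := by
    rintro s ⟨-, C, hC, h⟩
    refine le_of_mul_rpow_le (B := 9) hC fun k hk => ?_
    have hlow := h (0, 1 / 2) (Or.inl (zero_mem_carpet_false (by norm_num)))
      (((4 : ℝ) ^ k)⁻¹ / 2) (((3 : ℝ) ^ k)⁻¹ / 2) (by positivity)
      (by linarith [inv_four_pow_lt_inv_three_pow hk])
      (by linarith [inv_three_pow_le_one k])
    rw [div_div_div_cancel_right₀ (by norm_num), scale_ratio] at hlow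
    rw [Real.rpow_one]
    exact hlow.trans (coverNum_carpetUnion_inter_ball_half_le hk)
  exact le_antisymm (csSup_le ⟨1, hone⟩ hub) (le_csSup ⟨1, hub⟩ hone)

/-- **Theorem 1.4 (second part).** There is a graph-directed Bedford–McMullen carpet
over a non-irreducible graph — concretely a two-vertex `(×3,×4)`-carpet family — with
`dim_H X = dim_B X = 3/2 < 2 = dim_A X` and `dim_L X = 1`. -/
theorem exists_GDBMCarpet_hausdorff_eq_box_lt_assouad :
    ∃ S : GDBMCarpet, S.m = 3 ∧ S.n = 4 ∧ Fintype.card S.V = 2 ∧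
      ¬ S.GraphIrreducible ∧
      dimH S.Xunion = ENNReal.ofReal ((3 : ℝ) / 2) ∧
      lowerBoxDim S.Xunion = 3 / 2 ∧ upperBoxDim S.Xunion = 3 / 2 ∧
      assouadDim S.Xunion = 2 ∧ lowerDim S.Xunion = 1 ∧
      dimH S.Xunion = ENNReal.ofReal (boxDim S.Xunion) ∧
      boxDim S.Xunion < assouadDim S.Xunion := by
  have hlower : lowerBoxDim carpetUnion = 3 / 2 := tendsto_boxCounting_carpetUnion.liminf_eq
  have hupper : upperBoxDim carpetUnion = 3 / 2 := tendsto_boxCounting_carpetUnion.limsup_eq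
  refine ⟨twoCarpets, rfl, rfl, Fintype.card_bool, not_graphIrreducible_twoCarpets, ?_⟩
  rw [Xunion_twoCarpets, boxDim, hlower, hupper, dimH_carpetUnion, assouadDim_carpetUnion,
    lowerDim_carpetUnion]
  norm_num
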